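/- Let D be a set with two partial monoid structures (∘₁, s₁, t₁) and (∘₂, s₂, t₂) such that s₂ and t₂ are partial monoid homomorphisms of (D, ∘₁, s₁, t₁) to itself, s₁ and t₁ are partial monoid homomorphisms of (D, ∘₂, s₂, t₂) to itself, and the interchange law holds in the weak form: whenever both (x ∘₂ w) ∘₁ (y ∘₂ z) and (x ∘₁ y) ∘₂ (w ∘₁ z) are defined, they are equal. Then the interchange law holds in the strong form: whenever x ∘₂ w, y ∘₂ z, x ∘₁ y and w ∘₁ z are all defined, both (x ∘₂ w) ∘₁ (y ∘₂ z) and (x ∘₁ y) ∘₂ (w ∘₁ z) are defined and they are equal. -/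

import Mathlib

/-- A partial monoid: a set `C` with a partially defined multiplication
(`mul x y = some z` means `x ∘ y` is defined and equals `z`) and idempotent
partial identity maps `s t : C → C` such that `x ∘ y` is defined iff
`s x = t y`, `x ∘ s x = x`, `t x ∘ x = x`, and the multiplication is
associative in the strong sense. -/
structure PartialMonoid (C : Type*) where
  mul : C → C → Option C
  s : C → C
  t : C → C
  s_idem : ∀ x, s (s x) = s x
  t_idem : ∀ x, t (t x) = t x
  defined_iff : ∀ x y, (mul x y).isSome ↔ s x = t y
  mul_s : ∀ x, mul x (s x) = some x
  t_mul : ∀ x, mul (t x) x = some x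
  assoc : ∀ x y z, (mul z x).bind (fun w => mul w y) = (mul x y).bind (fun w => mul z w)

/-- A partial monoid homomorphism: commutes with `s` and `t`, and whenever
`x ∘₁ y` is defined, `F x ∘₂ F y` is defined and equals `F (x ∘₁ y)`. -/
def IsPMHom {C₁ : Type*} {C₂ : Type*} (M : PartialMonoid C₁) (N : PartialMonoid C₂)
    (F : C₁ → C₂) : Prop :=
  (∀ x, F (M.s x) = N.s (F x)) ∧ (∀ x, F (M.t x) = N.t (F x)) ∧
  (∀ x y z, M.mul x y = some z → N.mul (F x) (F y) = some (F z))

/-- A product that is defined witnesses the matching of source and target. -/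
theorem PartialMonoid.s_eq_t_of_mul {C : Type*} (M : PartialMonoid C) {x y z : C}
    (h : M.mul x y = some z) : M.s x = M.t y :=
  (M.defined_iff x y).1 (by simp [h])

/-- A product is defined as soon as source and target match. -/
theorem PartialMonoid.exists_mul_of_s_eq_t {C : Type*} (M : PartialMonoid C) {x y : C}
    (h : M.s x = M.t y) : ∃ z, M.mul x y = some z :=
  Option.isSome_iff_exists.1 ((M.defined_iff x y).2 h)

/-- If the source and target maps of `M` are homomorphisms of `N`, then the `N`-products of
two `M`-composable pairs are `M`-composable. -/
theorem PartialMonoid.exists_mul_of_mul {D : Type*} (M N : PartialMonoid D)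
    (hs : IsPMHom N N M.s) (ht : IsPMHom N N M.t) {x y w z xw yz xy wz : D}
    (hxw : N.mul x w = some xw) (hyz : N.mul y z = some yz)
    (hxy : M.mul x y = some xy) (hwz : M.mul w z = some wz) :
    ∃ p, M.mul xw yz = some p := by
  apply M.exists_mul_of_s_eq_t
  have h := hs.2.2 x w xw hxw
  rw [M.s_eq_t_of_mul hxy, M.s_eq_t_of_mul hwz, ht.2.2 y z yz hyz] at h
  exact (Option.some.inj h).symm

/-- If in addition the interchange law holds in the weak form (whenever both
`(x ∘₂ w) ∘₁ (y ∘₂ z)` and `(x ∘₁ y) ∘₂ (w ∘₁ z)` are defined, they agree),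
then it holds in the strong form: whenever `x ∘₂ w`, `y ∘₂ z`, `x ∘₁ y` and
`w ∘₁ z` are all defined, both iterated composites are defined and equal. -/
theorem double_interchange_strong {D : Type*} (M₁ M₂ : PartialMonoid D)
    (hs2 : IsPMHom M₁ M₁ M₂.s) (ht2 : IsPMHom M₁ M₁ M₂.t)
    (hs1 : IsPMHom M₂ M₂ M₁.s) (ht1 : IsPMHom M₂ M₂ M₁.t)
    (hweak : ∀ x y w z xw yz xy wz p q,
      M₂.mul x w = some xw → M₂.mul y z = some yz →
      M₁.mul x y = some xy → M₁.mul w z = some wz →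
      M₁.mul xw yz = some p → M₂.mul xy wz = some q → p = q) :
    ∀ x y w z xw yz xy wz,
      M₂.mul x w = some xw → M₂.mul y z = some yz →
      M₁.mul x y = some xy → M₁.mul w z = some wz →
      ∃ p, M₁.mul xw yz = some p ∧ M₂.mul xy wz = some p := by
  intro x y w z xw yz xy wz hxw hyz hxy hwz
  obtain ⟨p, hp⟩ := M₁.exists_mul_of_mul M₂ hs1 ht1 hxw hyz hxy hwz
  obtain ⟨q, hq⟩ := M₂.exists_mul_of_mul M₁ hs2 ht2 hxy hwz hxw hyz
  obtain rfl := hweak x y w z xw yz xy wz p q hxw hyz hxy hwz hp hq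
  exact ⟨p, hp, hq⟩
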